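/- (Hesse arrangement) Let k be an algebraically closed field of characteristic zero, S = k[x,y,z], and F = xyz·((x³ + y³ + z³)³ − 27x³y³z³), the product of the four triangles (twelve lines) occurring as the singular members of the Hesse pencil generated by the smooth cubic x³ + y³ + z³ and its Hessian xyz. Then the divisor {F = 0} is free with exponents (4, 7): the S-module T(F) = {v ∈ S³ : ⟨v, ∇F⟩ = 0} is free with a basis of two elements whose components are homogeneous of degrees 4 and 7 respectively. -/

import Mathlib

open MvPolynomial

/-- The gradient `∇F = (∂F/∂x, ∂F/∂y, ∂F/∂z)` of a polynomial in `k[x,y,z]`. -/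
noncomputable def grad {k : Type*} [CommRing k] (F : MvPolynomial (Fin 3) k) :
    Fin 3 → MvPolynomial (Fin 3) k :=
  fun i => pderiv i F

/-- The cross product `u ∧ v` of two triples of polynomials. -/
noncomputable def cross {k : Type*} [CommRing k] (u v : Fin 3 → MvPolynomial (Fin 3) k) :
    Fin 3 → MvPolynomial (Fin 3) k :=
  ![u 1 * v 2 - u 2 * v 1, u 2 * v 0 - u 0 * v 2, u 0 * v 1 - u 1 * v 0]

/-- The dot product `⟨u, v⟩` of two triples of polynomials. -/
noncomputable def dot {k : Type*} [CommRing k] (u v : Fin 3 → MvPolynomial (Fin 3) k) :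
    MvPolynomial (Fin 3) k :=
  u 0 * v 0 + u 1 * v 1 + u 2 * v 2

theorem deg_zero_of_dvd {k : Type*} [Field k] {p h : MvPolynomial (Fin 3) k} (i : Fin 3)
    (hd : p ∣ h) (hn : h ≠ 0) (h0 : degreeOf i h = 0) : degreeOf i p = 0 := by
  obtain ⟨c, rfl⟩ := hd
  rw [degreeOf_mul_eq (left_ne_zero_of_mul hn) (right_ne_zero_of_mul hn)] at h0
  omega

theorem no_prime {k : Type*} [Field k] {p : MvPolynomial (Fin 3) k} (hp : Prime p)
    (h : ∀ i, ∃ f, p ∣ f ∧ f ≠ 0 ∧ degreeOf i f = 0) : False := by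
  have hd : ∀ i, degreeOf i p = 0 := fun i => by
    obtain ⟨f, h1, h2, h3⟩ := h i
    exact deg_zero_of_dvd i h1 h2 h3
  have ht : p.totalDegree = 0 := by
    rw [totalDegree_eq_zero_iff]
    intro m hm i
    have := (degreeOf_le_iff.1 (hd i).le) m hm
    omega
  rw [totalDegree_eq_zero_iff_eq_C] at ht
  apply hp.not_isUnit
  rw [ht, isUnit_map_iff C]
  rw [isUnit_iff_ne_zero]
  intro h0
  rw [h0, map_zero] at ht
  exact hp.ne_zero ht

theorem good_X {k : Type*} [Field k] (i j : Fin 3) (h : i ≠ j) :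
    (X j : MvPolynomial (Fin 3) k) ≠ 0 ∧ degreeOf i (X j : MvPolynomial (Fin 3) k) = 0 :=
  ⟨X_ne_zero j, degreeOf_X_of_ne h⟩

theorem good_add {k : Type*} [Field k] [CharZero k] (i j l : Fin 3) (h : i ≠ j) (h' : i ≠ l) :
    (X j ^ 3 + X l ^ 3 : MvPolynomial (Fin 3) k) ≠ 0 ∧
      degreeOf i (X j ^ 3 + X l ^ 3 : MvPolynomial (Fin 3) k) = 0 := by
  constructor
  · intro h0
    have := congrArg (eval (fun _ => (1 : k))) h0
    norm_num at this
  · have := degreeOf_add_le (R := k) i (X j ^ 3) (X l ^ 3)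
    rw [degreeOf_X_pow_of_ne _ h, degreeOf_X_pow_of_ne _ h'] at this
    simpa using this

theorem good_sub {k : Type*} [Field k] [CharZero k] (i j l : Fin 3) (h : i ≠ j) (h' : i ≠ l)
    (hjl : j ≠ l) :
    (X j ^ 3 - X l ^ 3 : MvPolynomial (Fin 3) k) ≠ 0 ∧
      degreeOf i (X j ^ 3 - X l ^ 3 : MvPolynomial (Fin 3) k) = 0 := by
  constructor
  · intro h0
    have := congrArg (eval (fun t => if t = j then (1 : k) else 0)) h0
    simp [hjl.symm] at this
  · have := degreeOf_sub_le (R := k) i (X j ^ 3) (X l ^ 3)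
    rw [degreeOf_X_pow_of_ne _ h, degreeOf_X_pow_of_ne _ h'] at this
    simpa using this

theorem no_prime_XX {k : Type*} [Field k] {p : MvPolynomial (Fin 3) k} (hp : Prime p)
    (i j : Fin 3) (hij : i ≠ j) (hi : p ∣ X i) (hj : p ∣ X j) : False := by
  apply no_prime hp
  intro t
  by_cases h : t = i
  · subst h
    exact ⟨_, hj, good_X _ _ hij⟩
  · exact ⟨_, hi, good_X _ _ h⟩

theorem no_prime_XA {k : Type*} [Field k] [CharZero k] {p : MvPolynomial (Fin 3) k} (hp : Prime p)
    (i j l : Fin 3) (hij : i ≠ j) (hil : i ≠ l) (hi : p ∣ X i)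
    (hj : p ∣ X i ^ 3 + (X j ^ 3 + X l ^ 3)) : False := by
  have hj' := (dvd_add_right (dvd_pow hi (by norm_num : 3 ≠ 0))).1 hj
  apply no_prime hp
  intro t
  by_cases h : t = i
  · subst h
    exact ⟨_, hj', good_add _ _ _ hij hil⟩
  · exact ⟨_, hi, good_X _ _ h⟩

theorem no_prime_PQ {k : Type*} [Field k] [CharZero k] {p : MvPolynomial (Fin 3) k} (hp : Prime p)
    (hP : p ∣ X 0 ^ 3 + X 1 ^ 3 + X 2 ^ 3) (hQ : p ∣ X 0 * X 1 * X 2) : False := by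
  rcases hp.dvd_or_dvd hQ with h | h
  · rcases hp.dvd_or_dvd h with h | h
    · exact no_prime_XA hp 0 1 2 (by decide) (by decide) h (by convert hP using 1; ring)
    · exact no_prime_XA hp 1 0 2 (by decide) (by decide) h (by convert hP using 1; ring)
  · exact no_prime_XA hp 2 0 1 (by decide) (by decide) h (by convert hP using 1; ring)

/-- The two coefficients of the relation are relatively prime. -/
theorem relprime_PQ {k : Type*} [Field k] [CharZero k] (P Q : MvPolynomial (Fin 3) k)
    (hP : P = X 0 ^ 3 + X 1 ^ 3 + X 2 ^ 3) (hQ : Q = X 0 * X 1 * X 2) (hP0 : P ≠ 0) :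
    IsRelPrime (P ^ 2 * Q) (P ^ 3 - 108 * Q ^ 3) := by
  have hQ0 : Q ≠ 0 := by
    rw [hQ]; exact mul_ne_zero (mul_ne_zero (X_ne_zero _) (X_ne_zero _)) (X_ne_zero _)
  rw [UniqueFactorizationMonoid.isRelPrime_iff_no_prime_factors
    (mul_ne_zero (pow_ne_zero 2 hP0) hQ0)]
  intro p h1 h2 hp
  have key : p ∣ P ∧ p ∣ Q := by
    rcases hp.dvd_or_dvd h1 with h | h
    · have h := hp.dvd_of_dvd_pow h
      refine ⟨h, ?_⟩
      have h3 := (dvd_sub_right (dvd_pow h (by norm_num : 3 ≠ 0))).1 h2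
      have e : Q ^ 3 = C (108⁻¹ : k) * (108 * Q ^ 3) := by
        rw [← mul_assoc, ← map_ofNat (C : k →+* MvPolynomial (Fin 3) k) 108, ← C_mul]
        norm_num
      exact hp.dvd_of_dvd_pow (n := 3) (by rw [e]; exact h3.mul_left _)
    · refine ⟨?_, h⟩
      have h3 := (dvd_sub_left ((dvd_pow h (by norm_num : 3 ≠ 0)).mul_left 108)).1 h2
      exact hp.dvd_of_dvd_pow h3
  subst hP hQ
  exact no_prime_PQ hp key.1 key.2

theorem relprime_XY {k : Type*} [Field k] [CharZero k] :
    IsRelPrime (X 0 * (X 1 ^ 3 - X 2 ^ 3) : MvPolynomial (Fin 3) k)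
      (X 1 * (X 0 ^ 3 - X 2 ^ 3)) := by
  have g0 := good_sub (k := k) 0 1 2 (by decide) (by decide) (by decide)
  have g1 := good_sub (k := k) 1 0 2 (by decide) (by decide) (by decide)
  have g2 := good_sub (k := k) 2 0 1 (by decide) (by decide) (by decide)
  rw [UniqueFactorizationMonoid.isRelPrime_iff_no_prime_factors (mul_ne_zero (X_ne_zero _) g0.1)]
  intro p h1 h2 hp
  rcases hp.dvd_or_dvd h1 with h | h <;> rcases hp.dvd_or_dvd h2 with h' | h'
  · exact no_prime_XX hp 0 1 (by decide) h h'
  · have h3 := (dvd_sub_right (dvd_pow h (by norm_num : 3 ≠ 0))).1 h'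
    exact no_prime_XX hp 0 2 (by decide) h (hp.dvd_of_dvd_pow h3)
  · have h3 := (dvd_sub_right (dvd_pow h' (by norm_num : 3 ≠ 0))).1 h
    exact no_prime_XX hp 1 2 (by decide) h' (hp.dvd_of_dvd_pow h3)
  · apply no_prime hp
    intro t
    fin_cases t
    · exact ⟨_, h, g0⟩
    · exact ⟨_, h', g1⟩
    · refine ⟨_, ?_, g2⟩
      convert dvd_sub h' h using 1
      ring

/-- A triple orthogonal to the gradients of both cubics is a multiple of the degree `4` field. -/
theorem mult_of_kill {k : Type*} [Field k] [CharZero k] (a b c : MvPolynomial (Fin 3) k)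
    (h1 : X 0 ^ 2 * a + X 1 ^ 2 * b + X 2 ^ 2 * c = 0)
    (h2 : X 1 * X 2 * a + X 0 * X 2 * b + X 0 * X 1 * c = 0) :
    ∃ g, a = g * (X 0 * (X 1 ^ 3 - X 2 ^ 3)) ∧ b = g * (X 1 * (X 2 ^ 3 - X 0 ^ 3)) ∧
      c = g * (X 2 * (X 0 ^ 3 - X 1 ^ 3)) := by
  have e : (X 1 * (X 0 ^ 3 - X 2 ^ 3)) * a = (X 0 * (X 1 ^ 3 - X 2 ^ 3)) * (-b) := by
    linear_combination X 0 * X 1 * h1 - X 2 ^ 2 * h2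
  obtain ⟨g, hg⟩ := relprime_XY.dvd_of_dvd_mul_left (Dvd.intro _ e.symm)
  have g0 := good_sub (k := k) 0 1 2 (by decide) (by decide) (by decide)
  have hb : b = g * (X 1 * (X 2 ^ 3 - X 0 ^ 3)) := by
    apply mul_left_cancel₀ (mul_ne_zero (X_ne_zero 0) g0.1)
    rw [hg] at e
    linear_combination e
  refine ⟨g, by rw [hg]; ring, hb, ?_⟩
  apply mul_left_cancel₀ (mul_ne_zero (X_ne_zero (R := k) (0 : Fin 3)) (X_ne_zero 1))
  rw [hg, hb] at h2
  linear_combination h2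

/-- Hesse arrangement: the product
`F = xyz·((x³ + y³ + z³)³ − 27x³y³z³)` of the four triangles (twelve lines) of
singular members of the Hesse pencil is free with exponents `(4, 7)`: `T(F)` is free
with a homogeneous basis of degrees `4` and `7`. -/
theorem hesse_arrangement_free {k : Type*} [Field k] [IsAlgClosed k] [CharZero k]
    (F : MvPolynomial (Fin 3) k)
    (hF : F = X 0 * X 1 * X 2 *
        ((X 0 ^ 3 + X 1 ^ 3 + X 2 ^ 3) ^ 3 - 27 * X 0 ^ 3 * X 1 ^ 3 * X 2 ^ 3)) :
    ∃ u v : Fin 3 → MvPolynomial (Fin 3) k,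
      (∀ i, (u i).IsHomogeneous 4) ∧
      (∀ i, (v i).IsHomogeneous 7) ∧
      dot u (grad F) = 0 ∧ dot v (grad F) = 0 ∧
      ∀ w : Fin 3 → MvPolynomial (Fin 3) k, dot w (grad F) = 0 →
        ∃! ab : MvPolynomial (Fin 3) k × MvPolynomial (Fin 3) k,
          w = fun i => ab.1 * u i + ab.2 * v i := by
  obtain ⟨P, hP⟩ : ∃ P : MvPolynomial (Fin 3) k, P = X 0 ^ 3 + X 1 ^ 3 + X 2 ^ 3 := ⟨_, rfl⟩
  obtain ⟨Q, hQ⟩ : ∃ Q : MvPolynomial (Fin 3) k, Q = X 0 * X 1 * X 2 := ⟨_, rfl⟩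
  have hP0 : P ≠ 0 := by
    intro h0
    have := congrArg (eval (fun _ => (1 : k))) h0
    rw [hP] at this
    norm_num at this
  have hQ0 : Q ≠ 0 := by
    rw [hQ]; exact mul_ne_zero (mul_ne_zero (X_ne_zero _) (X_ne_zero _)) (X_ne_zero _)
  have d0 : pderiv 0 F = 9 * P ^ 2 * Q * X 0 ^ 2 + (P ^ 3 - 108 * Q ^ 3) * (X 1 * X 2) := by
    have h27 : pderiv (0 : Fin 3) (27 : MvPolynomial (Fin 3) k) = 0 :=
      (pderiv (0 : Fin 3)).map_natCast 27
    rw [hF, hP, hQ]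
    simp [pderiv_X, h27]
    ring
  have d1 : pderiv 1 F = 9 * P ^ 2 * Q * X 1 ^ 2 + (P ^ 3 - 108 * Q ^ 3) * (X 0 * X 2) := by
    have h27 : pderiv (1 : Fin 3) (27 : MvPolynomial (Fin 3) k) = 0 :=
      (pderiv (1 : Fin 3)).map_natCast 27
    rw [hF, hP, hQ]
    simp [pderiv_X, h27]
    ring
  have d2 : pderiv 2 F = 9 * P ^ 2 * Q * X 2 ^ 2 + (P ^ 3 - 108 * Q ^ 3) * (X 0 * X 1) := by
    have h27 : pderiv (2 : Fin 3) (27 : MvPolynomial (Fin 3) k) = 0 :=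
      (pderiv (2 : Fin 3)).map_natCast 27
    rw [hF, hP, hQ]
    simp [pderiv_X, h27]
    ring
  have hom : ∀ i n, (X i ^ n : MvPolynomial (Fin 3) k).IsHomogeneous n := isHomogeneous_X_pow
  have homU : ∀ i j l : Fin 3,
      (X i * (X j ^ 3 - X l ^ 3) : MvPolynomial (Fin 3) k).IsHomogeneous 4 := fun i j l =>
    (isHomogeneous_X k i).mul ((hom j 3).sub (hom l 3))
  have homV : ∀ i j l : Fin 3,
      (X i * (C (-1) * X i ^ 6 + C (-8) * (X i ^ 3 * (X j ^ 3 + X l ^ 3))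
        + C 5 * (X j ^ 6 + X l ^ 6) + C 34 * (X j ^ 3 * X l ^ 3)) :
        MvPolynomial (Fin 3) k).IsHomogeneous 7 := fun i j l =>
    (isHomogeneous_X k i).mul (((((hom i 6).C_mul _).add
      (((hom i 3).mul ((hom j 3).add (hom l 3))).C_mul _)).add
      (((hom j 6).add (hom l 6)).C_mul _)).add (((hom j 3).mul (hom l 3)).C_mul _))
  obtain ⟨u, hu⟩ : ∃ u : Fin 3 → MvPolynomial (Fin 3) k, u =
    ![X 0 * (X 1 ^ 3 - X 2 ^ 3), X 1 * (X 2 ^ 3 - X 0 ^ 3), X 2 * (X 0 ^ 3 - X 1 ^ 3)] := ⟨_, rfl⟩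
  obtain ⟨V, hV⟩ : ∃ V : Fin 3 → Fin 3 → Fin 3 → MvPolynomial (Fin 3) k, V = fun i j l =>
      X i * (C (-1) * X i ^ 6 + C (-8) * (X i ^ 3 * (X j ^ 3 + X l ^ 3))
        + C 5 * (X j ^ 6 + X l ^ 6) + C 34 * (X j ^ 3 * X l ^ 3)) := ⟨_, rfl⟩
  have hV' : ∀ i j l, V i j l = X i * (- X i ^ 6 - 8 * (X i ^ 3 * (X j ^ 3 + X l ^ 3))
        + 5 * (X j ^ 6 + X l ^ 6) + 34 * (X j ^ 3 * X l ^ 3)) := by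
    intro i j l
    rw [hV]
    simp only [map_neg, map_one, map_ofNat]
    ring
  obtain ⟨v, hv⟩ : ∃ v : Fin 3 → MvPolynomial (Fin 3) k, v =
    ![V 0 1 2, V 1 2 0, V 2 0 1] := ⟨_, rfl⟩
  have u0 : u 0 = X 0 * (X 1 ^ 3 - X 2 ^ 3) := by rw [hu]; rfl
  have u1 : u 1 = X 1 * (X 2 ^ 3 - X 0 ^ 3) := by rw [hu]; rfl
  have u2 : u 2 = X 2 * (X 0 ^ 3 - X 1 ^ 3) := by rw [hu]; rfl
  have v0 : v 0 = V 0 1 2 := by rw [hv]; rfl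
  have v1 : v 1 = V 1 2 0 := by rw [hv]; rfl
  have v2 : v 2 = V 2 0 1 := by rw [hv]; rfl
  have uP : X 0 ^ 2 * u 0 + X 1 ^ 2 * u 1 + X 2 ^ 2 * u 2 = 0 := by rw [u0, u1, u2]; ring
  have uQ : X 1 * X 2 * u 0 + X 0 * X 2 * u 1 + X 0 * X 1 * u 2 = 0 := by rw [u0, u1, u2]; ring
  have vP : X 0 ^ 2 * v 0 + X 1 ^ 2 * v 1 + X 2 ^ 2 * v 2 = -(P ^ 3 - 108 * Q ^ 3) := by
    rw [v0, v1, v2, hV', hV', hV', hP, hQ]; ring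
  have vQ : X 1 * X 2 * v 0 + X 0 * X 2 * v 1 + X 0 * X 1 * v 2 = 9 * P ^ 2 * Q := by
    rw [v0, v1, v2, hV', hV', hV', hP, hQ]; ring
  have dotF : ∀ w, dot w (grad F) =
      9 * P ^ 2 * Q * (X 0 ^ 2 * w 0 + X 1 ^ 2 * w 1 + X 2 ^ 2 * w 2) +
      (P ^ 3 - 108 * Q ^ 3) * (X 1 * X 2 * w 0 + X 0 * X 2 * w 1 + X 0 * X 1 * w 2) := by
    intro w
    simp only [dot, grad]
    rw [d0, d1, d2]
    ring
  have inv9 : (9 : MvPolynomial (Fin 3) k) * C (9⁻¹ : k) = 1 := by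
    rw [← map_ofNat (C : k →+* MvPolynomial (Fin 3) k) 9, ← C_mul]
    norm_num
  have h9 : (9 : MvPolynomial (Fin 3) k) * P ^ 2 * Q ≠ 0 :=
    mul_ne_zero (mul_ne_zero (left_ne_zero_of_mul_eq_one inv9) (pow_ne_zero 2 hP0)) hQ0
  have u0ne : u 0 ≠ 0 := by
    rw [u0]
    exact mul_ne_zero (X_ne_zero 0) (good_sub (k := k) 0 1 2 (by decide) (by decide) (by decide)).1
  refine ⟨u, v, ?_, ?_, ?_, ?_, ?_⟩
  · intro i
    fin_cases i
    · exact u0 ▸ homU 0 1 2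
    · exact u1 ▸ homU 1 2 0
    · exact u2 ▸ homU 2 0 1
  · subst hV
    intro i
    fin_cases i
    · exact v0 ▸ homV 0 1 2
    · exact v1 ▸ homV 1 2 0
    · exact v2 ▸ homV 2 0 1
  · rw [dotF, uP, uQ]; ring
  · rw [dotF, vP, vQ]; ring
  · intro w hw
    rw [dotF] at hw
    have hdvd : P ^ 2 * Q ∣ (P ^ 3 - 108 * Q ^ 3) *
        (X 1 * X 2 * w 0 + X 0 * X 2 * w 1 + X 0 * X 1 * w 2) :=
      ⟨-(9 * (X 0 ^ 2 * w 0 + X 1 ^ 2 * w 1 + X 2 ^ 2 * w 2)), by linear_combination hw⟩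
    obtain ⟨b', hb'⟩ := (relprime_PQ P Q hP hQ hP0).dvd_of_dvd_mul_left hdvd
    obtain ⟨b, hb⟩ : ∃ b, b' = 9 * b := ⟨C (9⁻¹ : k) * b', by rw [← mul_assoc, inv9, one_mul]⟩
    have wQ : X 1 * X 2 * w 0 + X 0 * X 2 * w 1 + X 0 * X 1 * w 2 = 9 * P ^ 2 * Q * b := by
      rw [hb', hb]; ring
    have wP : X 0 ^ 2 * w 0 + X 1 ^ 2 * w 1 + X 2 ^ 2 * w 2 = -(P ^ 3 - 108 * Q ^ 3) * b := by
      apply mul_left_cancel₀ h9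
      rw [wQ] at hw
      linear_combination hw
    obtain ⟨a, e0, e1, e2⟩ := mult_of_kill (w 0 - b * v 0) (w 1 - b * v 1) (w 2 - b * v 2)
      (by linear_combination wP - b * vP) (by linear_combination wQ - b * vQ)
    rw [← u0] at e0
    rw [← u1] at e1
    rw [← u2] at e2
    have hw' : w = fun i => a * u i + b * v i := by
      funext i
      fin_cases i
      · exact sub_eq_iff_eq_add.1 e0
      · exact sub_eq_iff_eq_add.1 e1
      · exact sub_eq_iff_eq_add.1 e2
    refine ⟨(a, b), hw', ?_⟩
    rintro ⟨a', b''⟩ h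
    have f0 : w 0 = a' * u 0 + b'' * v 0 := congrFun h 0
    have f1 : w 1 = a' * u 1 + b'' * v 1 := congrFun h 1
    have f2 : w 2 = a' * u 2 + b'' * v 2 := congrFun h 2
    have hbb : b'' = b := by
      apply mul_left_cancel₀ h9
      rw [f0, f1, f2] at wQ
      linear_combination wQ - a' * uQ - b'' * vQ
    subst hbb
    have haa : a' = a := by
      apply mul_right_cancel₀ u0ne
      linear_combination e0 - f0
    rw [haa]
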